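/- Let M be a set of exactly four items and consider two agents. There is no function Mech assigning to each pair (f_1, f_2) of dichotomous XOS valuations on M a finitely supported probability distribution over allocations such that: (i) every allocation in the support of Mech(f_1, f_2) maximizes the welfare f_1(A_1) + f_2(A_2) over all allocations; and (ii) Mech is truthful in expectation: for each agent i ∈ {1,2}, each pair (f_1,f_2) of dichotomous XOS valuations, and each dichotomous XOS deviation f'_i, the expectation of f_i(A_i) under Mech(f_1,f_2) is at least the expectation of f_i(A_i) under the distribution obtained by replacing f_i with f'_i. -/

import Mathlib

open Finset
open scoped Classical

variable {n : ℕ} {I : Type*} [DecidableEq I] [Fintype I]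

/-- An allocation assigns pairwise disjoint bundles of items to the agents
(items may remain unallocated). -/
def IsAllocation (A : Fin n → Finset I) : Prop :=
  ∀ i j : Fin n, i ≠ j → Disjoint (A i) (A j)

/-- The vector of utilities of an allocation under a profile of valuations. -/
def util {α : Type*} (f : Fin n → Finset I → α) (A : Fin n → Finset I) : Fin n → α :=
  fun i => f i (A i)

/-- The entries of the vector `u`, sorted in nondecreasing order. -/
noncomputable def sortedVec {α : Type*} [LinearOrder α] (u : Fin n → α) : List α :=
  (Finset.univ.val.map u).sort (· ≤ ·)

/-- `u` Lorenz-dominates `v`: for each `k`, the sum of the `k` smallest entries of `u`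
is at least the sum of the `k` smallest entries of `v`. -/
def LorenzGE {α : Type*} [LinearOrder α] [AddCommMonoid α] (u v : Fin n → α) : Prop :=
  ∀ k : ℕ, ((sortedVec v).take k).sum ≤ ((sortedVec u).take k).sum

/-- A matroid rank function: a normalized submodular valuation with dichotomous marginals. -/
structure IsMRF (f : Finset I → ℕ) : Prop where
  empty : f ∅ = 0
  submod : ∀ S T : Finset I, S ⊆ T → ∀ a : I,
      f (insert a T) + f S ≤ f (insert a S) + f T
  dichot : ∀ (S : Finset I) (a : I), f (insert a S) = f S ∨ f (insert a S) = f S + 1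

/-- Non-redundancy: removing any item from any agent's bundle strictly decreases its value. -/
def NonRedundant (f : Fin n → Finset I → ℕ) (A : Fin n → Finset I) : Prop :=
  ∀ i : Fin n, ∀ a ∈ A i, f i ((A i).erase a) < f i (A i)

/-- A Lorenz dominating allocation. -/
def LorenzDominating (f : Fin n → Finset I → ℕ) (A : Fin n → Finset I) : Prop :=
  ∀ B : Fin n → Finset I, IsAllocation B → LorenzGE (util f A) (util f B)

/-- The σ-perturbed utilities: agent `i` gets `f i (A i) + σ(i)/n²`, where the priority
`σ(i)` ranges over `{1,…,n}`. -/
noncomputable def pUtil (σ : Equiv.Perm (Fin n)) (f : Fin n → Finset I → ℕ)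
    (A : Fin n → Finset I) : Fin n → ℝ :=
  fun i => (f i (A i) : ℝ) + (((σ i : ℕ) : ℝ) + 1) / (n : ℝ) ^ 2

/-- A σ-Lorenz dominating allocation. -/
def SigmaLorenzDom (σ : Equiv.Perm (Fin n)) (f : Fin n → Finset I → ℕ)
    (A : Fin n → Finset I) : Prop :=
  ∀ B : Fin n → Finset I, IsAllocation B → LorenzGE (pUtil σ f A) (pUtil σ f B)

/-- Restriction of a valuation to a subset `D` of the items. -/
def restrictVal (f : Finset I → ℕ) (D : Finset I) : Finset I → ℕ := fun S => f (S ∩ D)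

/-- A partition of all the items into `n` (possibly empty) bundles. -/
def IsPartition (P : Fin n → Finset I) : Prop :=
  (∀ i j : Fin n, i ≠ j → Disjoint (P i) (P j)) ∧ ∀ a : I, ∃ j, a ∈ P j

/-- An XOS valuation: the pointwise maximum of a finite nonempty family of
nonnegative additive valuations. -/
def IsXOS (f : Finset I → ℝ) : Prop :=
  ∃ (k : ℕ) (w : Fin (k + 1) → I → ℝ),
    (∀ t a, 0 ≤ w t a) ∧
    ∀ S : Finset I, f S = Finset.univ.sup' Finset.univ_nonempty (fun t => ∑ a ∈ S, w t a)

/-- A dichotomous valuation (real-valued version). -/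
def IsDichotomousR (f : Finset I → ℝ) : Prop :=
  ∀ (S : Finset I) (a : I), f (insert a S) = f S ∨ f (insert a S) = f S + 1

/-- Envy-freeness up to one good. -/
def EF1 (f : Fin n → Finset I → ℝ) (A : Fin n → Finset I) : Prop :=
  ∀ i j : Fin n, f i (A j) ≤ f i (A i) ∨ ∃ e ∈ A j, f i ((A j).erase e) ≤ f i (A i)

/-- The maximum welfare attainable by a set `S` of agents. -/
noncomputable def maxWelfare (f : Fin n → Finset I → ℕ) (S : Finset (Fin n)) : ℕ :=
  Finset.sup (Finset.univ.filter fun B : Fin n → Finset I => IsAllocation B)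
    (fun B => ∑ j ∈ S, f j (B j))

/-- An allocation extended with index `none` for the set of unallocated items. -/
def extAlloc (A : Fin n → Finset I) : Option (Fin n) → Finset I
  | none => Finset.univ \ Finset.univ.biUnion A
  | some i => A i

/-- The number of items of `{0, 1}` in a bundle. -/
def pairVal (S : Finset (Fin 4)) : ℕ := #(S ∩ {0, 1})

/-- The maximum of the additive valuations supported on `{0, 1}` and on `{2}`. -/
def pairOrSingleVal (S : Finset (Fin 4)) : ℕ := max #(S ∩ {0, 1}) #(S ∩ {2})

lemma sum_indicator_eq_card_inter {α : Type*} [DecidableEq α] (S T : Finset α) :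
    ∑ a ∈ S, (if a ∈ T then (1 : ℝ) else 0) = #(S ∩ T) := by
  rw [Finset.sum_boole, Finset.filter_mem_eq_inter]

lemma isXOS_pairVal : IsXOS fun S => (pairVal S : ℝ) := by
  refine ⟨0, fun _ a => if a ∈ ({0, 1} : Finset (Fin 4)) then 1 else 0, ?_, ?_⟩
  · intro t a
    dsimp only
    split_ifs <;> norm_num
  · intro S
    simp only [sum_indicator_eq_card_inter, Finset.sup'_const, pairVal]

lemma isXOS_pairOrSingleVal : IsXOS fun S => (pairOrSingleVal S : ℝ) := by
  refine ⟨1, fun t a => if a ∈ (![{0, 1}, {2}] t : Finset (Fin 4)) then 1 else 0, ?_, ?_⟩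
  · intro t a
    dsimp only
    split_ifs <;> norm_num
  · intro S
    simp only [sum_indicator_eq_card_inter]
    apply le_antisymm
    · rw [pairOrSingleVal, Nat.cast_max]
      exact max_le (Finset.le_sup' (fun t => (#(S ∩ ![{0, 1}, {2}] t) : ℝ)) (mem_univ 0))
        (Finset.le_sup' (fun t => (#(S ∩ ![{0, 1}, {2}] t) : ℝ)) (mem_univ 1))
    · refine Finset.sup'_le _ _ fun t _ => Nat.cast_le.2 ?_
      fin_cases t
      · exact le_max_left _ _
      · exact le_max_right _ _

lemma isDichotomousR_pairVal : IsDichotomousR fun S => (pairVal S : ℝ) := by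
  have h : ∀ (S : Finset (Fin 4)) (a : Fin 4),
      pairVal (insert a S) = pairVal S ∨ pairVal (insert a S) = pairVal S + 1 := by decide
  intro S a
  beta_reduce
  exact_mod_cast h S a

lemma isDichotomousR_pairOrSingleVal : IsDichotomousR fun S => (pairOrSingleVal S : ℝ) := by
  have h : ∀ (S : Finset (Fin 4)) (a : Fin 4),
      pairOrSingleVal (insert a S) = pairOrSingleVal S ∨
        pairOrSingleVal (insert a S) = pairOrSingleVal S + 1 := by decide
  intro S a
  beta_reduce
  exact_mod_cast h S a

lemma pairOrSingleVal_add_le {S T : Finset (Fin 4)} (h : Disjoint S T) :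
    pairOrSingleVal S + pairOrSingleVal T ≤ 3 := by
  revert S T
  decide

/-- If the agent reporting `pairVal` and the one reporting `pairOrSingleVal` reach welfare three,
then the former receives both items `0` and `1`. -/
lemma two_le_pairOrSingleVal {S T : Finset (Fin 4)} (h : Disjoint S T)
    (hST : 3 ≤ pairVal S + pairOrSingleVal T) : 2 ≤ pairOrSingleVal S := by
  revert S T
  decide

/-- Agent `i` values every allocation that maximizes welfare after deviating to `pairVal`
at two or more. -/
lemma two_le_of_isMaxWelfare_update (i : Fin 2) {A : Fin 2 → Finset (Fin 4)}
    (hA : IsAllocation A)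
    {F : Fin 2 → Finset (Fin 4) → ℝ}
    (hF : F = Function.update (fun _ S => (pairOrSingleVal S : ℝ)) i (fun S => (pairVal S : ℝ)))
    (hmax : ∀ B : Fin 2 → Finset (Fin 4), IsAllocation B →
      F 0 (B 0) + F 1 (B 1) ≤ F 0 (A 0) + F 1 (A 1)) :
    2 ≤ pairOrSingleVal (A i) := by
  subst hF
  have hp : pairVal {0, 1} = 2 := by decide
  have hs : pairOrSingleVal {2} = 1 := by decide
  fin_cases i
  · have hB : IsAllocation (![{0, 1}, {2}] : Fin 2 → Finset (Fin 4)) := by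
      unfold IsAllocation; decide
    have h := hmax _ hB
    simp [Function.update, hp, hs] at h
    refine two_le_pairOrSingleVal (hA 0 1 (by decide)) ?_
    have hthree : (3 : ℝ) ≤ pairVal (A 0) + pairOrSingleVal (A 1) := by linarith
    exact_mod_cast hthree
  · have hB : IsAllocation (![{2}, {0, 1}] : Fin 2 → Finset (Fin 4)) := by
      unfold IsAllocation; decide
    have h := hmax _ hB
    simp [Function.update, hp, hs] at h
    refine two_le_pairOrSingleVal (hA 1 0 (by decide)) ?_
    have hthree : (3 : ℝ) ≤ pairVal (A 1) + pairOrSingleVal (A 0) := by linarith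
    exact_mod_cast hthree

/-- There is no randomized (finitely supported) allocation mechanism for two agents with
dichotomous XOS valuations on four items that is truthful in expectation and whose
support always consists of welfare-maximizing allocations. -/
theorem no_TIE_welfare_maximizing_dichotomous_XOS :
    ¬ ∃ Mech : (Fin 2 → Finset (Fin 4) → ℝ) → ((Fin 2 → Finset (Fin 4)) → ℝ),
      -- Mech F is a probability distribution over allocations
      (∀ F : Fin 2 → Finset (Fin 4) → ℝ,
        (∀ i, IsXOS (F i) ∧ IsDichotomousR (F i)) →
        (∀ A : Fin 2 → Finset (Fin 4), 0 ≤ Mech F A) ∧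
        (∑ A : Fin 2 → Finset (Fin 4), Mech F A = 1)) ∧
      -- (i) every allocation in the support maximizes welfare
      (∀ F : Fin 2 → Finset (Fin 4) → ℝ,
        (∀ i, IsXOS (F i) ∧ IsDichotomousR (F i)) →
        ∀ A : Fin 2 → Finset (Fin 4), Mech F A ≠ 0 →
          IsAllocation A ∧
          ∀ B : Fin 2 → Finset (Fin 4), IsAllocation B →
            F 0 (B 0) + F 1 (B 1) ≤ F 0 (A 0) + F 1 (A 1)) ∧
      -- (ii) truthfulness in expectation
      (∀ F : Fin 2 → Finset (Fin 4) → ℝ,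
        (∀ i, IsXOS (F i) ∧ IsDichotomousR (F i)) →
        ∀ i : Fin 2, ∀ f' : Finset (Fin 4) → ℝ, IsXOS f' ∧ IsDichotomousR f' →
          ∑ A : Fin 2 → Finset (Fin 4), Mech (Function.update F i f') A * F i (A i)
            ≤ ∑ A : Fin 2 → Finset (Fin 4), Mech F A * F i (A i)) := by
  rintro ⟨Mech, hprob, hopt, htruth⟩
  set f : Finset (Fin 4) → ℝ := fun S => (pairOrSingleVal S : ℝ)
  set g : Finset (Fin 4) → ℝ := fun S => (pairVal S : ℝ)
  have hfv : IsXOS f ∧ IsDichotomousR f := ⟨isXOS_pairOrSingleVal, isDichotomousR_pairOrSingleVal⟩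
  have hgv : IsXOS g ∧ IsDichotomousR g := ⟨isXOS_pairVal, isDichotomousR_pairVal⟩
  have hF : ∀ i : Fin 2, IsXOS ((fun _ => f) i : Finset (Fin 4) → ℝ) ∧
      IsDichotomousR ((fun _ => f) i : Finset (Fin 4) → ℝ) := fun _ => hfv
  have two_le : ∀ i : Fin 2, 2 ≤ ∑ A, Mech (fun _ => f) A * f (A i) := by
    intro i
    have hG : ∀ j, IsXOS (Function.update (fun _ : Fin 2 => f) i g j) ∧
        IsDichotomousR (Function.update (fun _ : Fin 2 => f) i g j) := by
      intro j
      rcases eq_or_ne j i with rfl | hj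
      · simpa using hgv
      · simpa [hj] using hfv
    refine le_trans ?_ (htruth (fun _ => f) hF i g hgv)
    obtain ⟨hnonneg, hsum⟩ := hprob _ hG
    calc (2 : ℝ) = ∑ A, Mech (Function.update (fun _ => f) i g) A * 2 := by
          rw [← Finset.sum_mul, hsum, one_mul]
      _ ≤ _ := by
          refine Finset.sum_le_sum fun A _ => ?_
          by_cases h0 : Mech (Function.update (fun _ => f) i g) A = 0
          · simp [h0]
          · obtain ⟨hA, hmax⟩ := hopt _ hG A h0
            refine mul_le_mul_of_nonneg_left ?_ (hnonneg A)
            have h := two_le_of_isMaxWelfare_update i hA rfl hmax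
            simp only [f]
            exact_mod_cast h
  have le_three : ∑ A, Mech (fun _ => f) A * f (A 0) + ∑ A, Mech (fun _ => f) A * f (A 1) ≤ 3 := by
    obtain ⟨hnonneg, hsum⟩ := hprob _ hF
    calc _ = ∑ A, Mech (fun _ => f) A * (f (A 0) + f (A 1)) := by
          simp only [mul_add, Finset.sum_add_distrib]
      _ ≤ ∑ A, Mech (fun _ => f) A * 3 := by
          refine Finset.sum_le_sum fun A _ => ?_
          by_cases h0 : Mech (fun _ => f) A = 0
          · simp [h0]
          · refine mul_le_mul_of_nonneg_left ?_ (hnonneg A)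
            have h := pairOrSingleVal_add_le ((hopt _ hF A h0).1 0 1 (by decide))
            simp only [f]
            exact_mod_cast h
      _ = 3 := by rw [← Finset.sum_mul, hsum, one_mul]
  linarith [two_le 0, two_le 1]
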